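/- Let (V,σ) be a braided vector space with σ(e_i⊗e_j) = q_{ij} e_j⊗e_i on a basis e₁,…,e_N. For a Lyndon word p = e_{j₁}⊗⋯⊗e_{j_m}, set Q = Π_{k,l ∈ {j₁,…,j_m}} q_{kl}. Then the n-fold quantum shuffle power p sh_σ p sh_σ ⋯ sh_σ p (n factors) equals (n)_Q! · p^{⊗n} plus a linear combination of basis words strictly smaller than p^{⊗n} in the lexicographic order, where (n)_Q! = (n)_Q (n−1)_Q ⋯ (1)_Q and (k)_Q = (Q^k−1)/(Q−1). -/

import Mathlib

noncomputable section
variable {K : Type*} [Field K]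

/-- `p` is a Lyndon word. -/
def IsLyndon {N : ℕ} (p : List (Fin N)) : Prop :=
  p ≠ [] ∧ ∀ a b : List (Fin N), a ≠ [] → b ≠ [] → p = a ++ b → List.Lex (· < ·) p b

/-- `x ≥ y` in the lexicographic order on words. -/
def WGe {N : ℕ} (x y : List (Fin N)) : Prop :=
  x = y ∨ List.Lex (· < ·) y x

/-- prepend the letter `a` to every word, linearly. -/
def consMap {N : ℕ} (a : Fin N) : (List (Fin N) →₀ K) →ₗ[K] (List (Fin N) →₀ K) :=
  Finsupp.lmapDomain K K (List.cons a)

/-- the quantum shuffle product of two basis words, for the diagonal braiding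
`σ(e_i ⊗ e_j) = Q i j • e_j ⊗ e_i`; it satisfies
`(a∷u) ш (b∷v) = a∷(u ш (b∷v)) + (∏_{c ∈ a∷u} Q c b) • b∷((a∷u) ш v)`,
which is exactly `Σ_{w ∈ S_{i,j}} T_w`. -/
def qshW {N : ℕ} (Q : Fin N → Fin N → K) : List (Fin N) → List (Fin N) → (List (Fin N) →₀ K)
  | [], y => Finsupp.single y 1
  | x, [] => Finsupp.single x 1
  | a :: u, b :: v =>
      consMap a (qshW Q u (b :: v)) +
        (((a :: u).map fun c => Q c b).prod) • consMap b (qshW Q (a :: u) v)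
  termination_by x y => x.length + y.length

/-- the quantum shuffle product, extended bilinearly. -/
def shW {N : ℕ} (Q : Fin N → Fin N → K) :
    (List (Fin N) →₀ K) → (List (Fin N) →₀ K) → (List (Fin N) →₀ K) :=
  fun f g => f.sum fun x a => g.sum fun y b => (a * b) • qshW Q x y

/-- the iterated quantum shuffle product `l₁ ш (l₂ ш (⋯ ш l_r))` of a list of words. -/
def prodShW {N : ℕ} (Q : Fin N → Fin N → K) : List (List (Fin N)) → (List (Fin N) →₀ K)
  | [] => Finsupp.single [] 1
  | l :: L => shW Q (Finsupp.single l 1) (prodShW Q L)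

/-- `Sh u v x`: the word `x` is an (ordinary) shuffle of `u` and `v`. -/
inductive Sh {N : ℕ} : List (Fin N) → List (Fin N) → List (Fin N) → Prop
  | nil : Sh [] [] []
  | left (a : Fin N) {u v x : List (Fin N)} : Sh u v x → Sh (a :: u) v (a :: x)
  | right (b : Fin N) {u v x : List (Fin N)} : Sh u v x → Sh u (b :: v) (b :: x)

theorem Sh.length {N : ℕ} {u v x : List (Fin N)} (h : Sh u v x) :
    x.length = u.length + v.length := by
  induction h with
  | nil => rfl
  | left a h ih => simp [ih]; omega
  | right a h ih => simp [ih]; omega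

theorem Sh.nil_left {N : ℕ} (v : List (Fin N)) : Sh [] v v := by
  induction v with
  | nil => exact Sh.nil
  | cons b v ih => exact Sh.right b ih

theorem Sh.nil_right {N : ℕ} (v : List (Fin N)) : Sh v [] v := by
  induction v with
  | nil => exact Sh.nil
  | cons b v ih => exact Sh.left b ih

theorem Sh.eq_of_nil_right {N : ℕ} {u v x : List (Fin N)} (h : Sh u v x) (hv : v = []) :
    x = u := by
  induction h with
  | nil => rfl
  | left a h ih => rw [ih hv]
  | right a h ih => cases hv

theorem Sh.eq_of_nil_left {N : ℕ} {u v x : List (Fin N)} (h : Sh u v x) (hv : u = []) :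
    x = v := by
  induction h with
  | nil => rfl
  | right a h ih => rw [ih hv]
  | left a h ih => cases hv

theorem Sh.append {N : ℕ} {u v x u' v' x' : List (Fin N)} (h : Sh u v x) (h' : Sh u' v' x') :
    Sh (u ++ u') (v ++ v') (x ++ x') := by
  induction h with
  | nil => exact h'
  | left a h ih => exact Sh.left a ih
  | right a h ih => exact Sh.right a ih

theorem Sh.append_left {N : ℕ} (u v : List (Fin N)) : Sh u v (u ++ v) := by
  simpa using (Sh.nil_right u).append (Sh.nil_left v)

theorem Sh.append_right {N : ℕ} (u v : List (Fin N)) : Sh u v (v ++ u) := by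
  simpa using (Sh.nil_left v).append (Sh.nil_right u)

theorem Sh.split {N : ℕ} {s t x : List (Fin N)} (h : Sh s t x) : ∀ k ≤ x.length,
    ∃ s1 s2 t1 t2 x1 x2, s = s1 ++ s2 ∧ t = t1 ++ t2 ∧ x = x1 ++ x2 ∧ x1.length = k ∧
      Sh s1 t1 x1 ∧ Sh s2 t2 x2 := by
  induction h with
  | nil =>
    intro k hk
    exact ⟨[], [], [], [], [], [], rfl, rfl, rfl, by simp at hk; simp [hk], Sh.nil, Sh.nil⟩
  | @left a u v x h ih =>
    intro k hk
    cases k with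
    | zero => exact ⟨[], _, [], _, [], _, rfl, rfl, rfl, rfl, Sh.nil, Sh.left a h⟩
    | succ k =>
      obtain ⟨s1, s2, t1, t2, x1, x2, rfl, rfl, rfl, hl, h1, h2⟩ := ih k (by simpa using hk)
      exact ⟨a :: s1, s2, t1, t2, a :: x1, x2, rfl, rfl, rfl, by simp [hl], Sh.left a h1, h2⟩
  | @right a u v x h ih =>
    intro k hk
    cases k with
    | zero => exact ⟨[], _, [], _, [], _, rfl, rfl, rfl, rfl, Sh.nil, Sh.right a h⟩
    | succ k =>
      obtain ⟨s1, s2, t1, t2, x1, x2, rfl, rfl, rfl, hl, h1, h2⟩ := ih k (by simpa using hk)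
      exact ⟨s1, s2, a :: t1, t2, a :: x1, x2, rfl, rfl, rfl, by simp [hl], Sh.right a h1, h2⟩

/-- a fixed shuffle pattern is strictly monotone in the second word. -/
theorem Sh.mono {N : ℕ} {u w x : List (Fin N)} (h : Sh u w x) : ∀ w' : List (Fin N),
    w.length = w'.length → w < w' → ∃ x', Sh u w' x' ∧ x < x' := by
  induction h with
  | nil =>
    intro w' hl hw
    cases w' with
    | nil => exact absurd hw (lt_irrefl _)
    | cons => simp at hl
  | left a h ih =>
    intro w' hl hw
    obtain ⟨x', h1, h2⟩ := ih w' hl hw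
    exact ⟨a :: x', Sh.left a h1, List.cons_lt_cons_iff.2 (Or.inr ⟨rfl, h2⟩)⟩
  | @right b u v x h ih =>
    intro w' hl hw
    cases w' with
    | nil => simp at hl
    | cons c w' =>
      rcases List.cons_lt_cons_iff.1 hw with h1 | ⟨rfl, h1⟩
      · exact ⟨c :: (u ++ w'), Sh.right c (Sh.append_left _ _),
          List.cons_lt_cons_iff.2 (Or.inl h1)⟩
      · obtain ⟨x', h2, h3⟩ := ih w' (by simpa using hl) h1
        exact ⟨b :: x', Sh.right b h2, List.cons_lt_cons_iff.2 (Or.inr ⟨rfl, h3⟩)⟩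

theorem cons_le_cons' {N : ℕ} (a : Fin N) {x y : List (Fin N)} (h : x ≤ y) :
    a :: x ≤ a :: y := by
  rcases h.lt_or_eq with h | rfl
  · exact le_of_lt (List.cons_lt_cons_iff.2 (Or.inr ⟨rfl, h⟩))
  · exact le_rfl

theorem le_of_cons_le_cons' {N : ℕ} {a : Fin N} {x y : List (Fin N)} (h : a :: x ≤ a :: y) :
    x ≤ y := by
  by_contra hc
  exact absurd h (not_le.2 (List.cons_lt_cons_iff.2 (Or.inr ⟨rfl, not_le.1 hc⟩)))

theorem append_le_append_left' {N : ℕ} (a : List (Fin N)) {x y : List (Fin N)}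
    (h : a ++ x ≤ a ++ y) : x ≤ y := by
  induction a with
  | nil => exact h
  | cons c a ih => exact ih (le_of_cons_le_cons' h)

theorem le_append' {N : ℕ} (a t : List (Fin N)) : a ≤ a ++ t := by
  induction a with
  | nil => exact not_lt.1 (by simp)
  | cons c a ih => exact cons_le_cons' c ih

/-- the exchange lemma -/
theorem exchange {N : ℕ} : ∀ (m : ℕ) (z u v x : List (Fin N)),
    z.length + u.length + v.length ≤ m → v ≤ u → Sh (z ++ u) v x →
    ∃ x', Sh u (z ++ v) x' ∧ x ≤ x' := by
  intro m
  induction m with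
  | zero =>
    intro z u v x hm hvu h
    have hz : z = [] := by apply List.eq_nil_of_length_eq_zero; omega
    subst hz
    exact ⟨x, h, le_rfl⟩
  | succ m ih =>
    intro z u v x hm hvu h
    cases z with
    | nil => exact ⟨x, h, le_rfl⟩
    | cons c z =>
      cases v with
      | nil =>
        rw [h.eq_of_nil_right rfl]
        exact ⟨_, by simpa using Sh.append_right u (c :: z), le_rfl⟩
      | cons d v =>
        cases h with
        | left _ h =>
          obtain ⟨x', h1, h2⟩ := ih z u (d :: v) _ (by simp at hm ⊢; omega) hvu h
          exact ⟨c :: x', Sh.right c h1, cons_le_cons' c h2⟩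
        | right _ h =>
          cases u with
          | nil => exact absurd hvu (not_le.2 (by simp))
          | cons e u =>
            rcases lt_trichotomy d e with hde | rfl | hde
            · exact ⟨e :: (u ++ (c :: z ++ d :: v)), Sh.left e (Sh.append_left _ _),
                le_of_lt (List.cons_lt_cons_iff.2 (Or.inl hde))⟩
            · obtain ⟨x', h1, h2⟩ := ih (c :: z ++ [d]) u v _ (by simp at hm ⊢; omega)
                (le_of_cons_le_cons' hvu) (by simpa using h)
              exact ⟨d :: x', Sh.left d (by simpa using h1), cons_le_cons' d h2⟩
            · exact absurd hvu (not_le.2 (List.cons_lt_cons_iff.2 (Or.inl hde)))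

theorem Sh.symm {N : ℕ} {u v x : List (Fin N)} (h : Sh u v x) : Sh v u x := by
  induction h with
  | nil => exact Sh.nil
  | left a h ih => exact Sh.right a ih
  | right a h ih => exact Sh.left a ih

/-- a maximal shuffle may start with the larger word. -/
theorem exchange_cons {N : ℕ} {c : Fin N} {u v x : List (Fin N)} (hvu : v ≤ c :: u)
    (h : Sh (c :: u) v x) : ∃ x', Sh u v x' ∧ x ≤ c :: x' := by
  cases h with
  | left _ h => exact ⟨_, h, le_rfl⟩
  | @right d _ v x h =>
    rcases lt_trichotomy d c with hde | rfl | hde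
    · exact ⟨_, Sh.append_left _ _, le_of_lt (List.cons_lt_cons_iff.2 (Or.inl hde))⟩
    · obtain ⟨x', h1, h2⟩ := exchange _ [d] u v _ le_rfl
        (le_of_cons_le_cons' hvu) h
      exact ⟨x', h1, cons_le_cons' d h2⟩
    · exact absurd hvu (not_le.2 (List.cons_lt_cons_iff.2 (Or.inl hde)))

theorem IsLyndon.lt {N : ℕ} {p a b : List (Fin N)} (hp : IsLyndon p) (ha : a ≠ []) (hb : b ≠ [])
    (h : p = a ++ b) : p < b := hp.2 a b ha hb h

theorem IsLyndon.le {N : ℕ} {p a b : List (Fin N)} (hp : IsLyndon p) (hb : b ≠ [])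
    (h : p = a ++ b) : p ≤ b := by
  by_cases ha : a = []
  · subst ha; exact le_of_eq h
  · exact le_of_lt (hp.lt ha hb h)

/-- the `n`-th concatenation power -/
def wpow {N : ℕ} (p : List (Fin N)) (n : ℕ) : List (Fin N) := (List.replicate n p).flatten

theorem wpow_succ {N : ℕ} (p : List (Fin N)) (n : ℕ) : wpow p (n + 1) = p ++ wpow p n := by
  simp [wpow, List.replicate_succ]

theorem wpow_succ_of {N : ℕ} {p s t : List (Fin N)} (h : p = s ++ t) (n : ℕ) :
    wpow p (n + 1) = s ++ (t ++ wpow p n) := by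
  rw [wpow_succ, ← List.append_assoc, ← h]

theorem wpow_zero {N : ℕ} (p : List (Fin N)) : wpow p 0 = [] := rfl

theorem sh_le {N : ℕ} {p : List (Fin N)} (hp : IsLyndon p) : ∀ (k : ℕ) (v β x : List (Fin N)),
    p = β ++ v → Sh p (v ++ wpow p k) x → x ≤ v ++ wpow p (k + 1) := by
  intro k
  induction k with
  | zero =>
    intro v
    induction v with
    | nil =>
      intro β x hv h
      rw [h.eq_of_nil_right rfl]
      simp [wpow]
    | cons b v ih =>
      intro β x hv h
      obtain ⟨x', h1, h2⟩ := exchange_cons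
        ((hp.le (by simp) hv).trans (le_append' _ _)) h.symm
      exact h2.trans (cons_le_cons' b (ih (β ++ [b]) x' (by simpa using hv) h1.symm))
  | succ k ihk =>
    intro v
    induction v with
    | nil =>
      intro β x hv h
      rw [List.nil_append, wpow_succ] at h ⊢
      exact ihk p [] x rfl h
    | cons b v ih =>
      intro β x hv h
      obtain ⟨x', h1, h2⟩ := exchange_cons
        ((hp.le (by simp) hv).trans (le_append' _ _)) h.symm
      exact h2.trans (cons_le_cons' b (ih (β ++ [b]) x' (by simpa using hv) h1.symm))

theorem sh_pow_le {N : ℕ} {p : List (Fin N)} (hp : IsLyndon p) (k : ℕ) (x : List (Fin N))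
    (h : Sh p (wpow p k) x) : x ≤ wpow p (k + 1) :=
  sh_le hp k [] p x (by simp) h

theorem sh_ne {N : ℕ} {p α β u v y : List (Fin N)} (hp : IsLyndon p) (hα : α ≠ []) (hu : u ≠ [])
    (h1 : p = α ++ u) (h2 : p = β ++ v) (h : Sh α β y) : y ≠ p := by
  rintro rfl
  have h3 : Sh y (wpow y 1) (y ++ (u ++ v)) := by
    have := h.append (Sh.append_left u v)
    rw [← h1, ← h2] at this
    simpa [wpow] using this
  have h4 := sh_pow_le hp 1 _ h3
  rw [wpow_succ] at h4
  have h5 := append_le_append_left' _ h4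
  have h6 : wpow y 1 = y := by simp [wpow]
  rw [h6] at h5
  exact absurd (hp.lt hα hu h1) (not_lt.2 ((le_append' u v).trans h5))

theorem sh_ne_pow {N : ℕ} {p α β u v y x : List (Fin N)} {k : ℕ} (hp : IsLyndon p)
    (hα : α ≠ []) (hβ : β ≠ [])
    (h1 : p = α ++ u) (h2 : p = β ++ v) (h : Sh α β y) (hl : α.length + β.length ≤ p.length)
    (hx : Sh u (v ++ wpow p k) x) : y ++ x ≠ wpow p (k + 2) := by
  intro he
  have hly := h.length
  have hlx := hx.length
  have hp1 := congrArg List.length h1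
  have hp2 := congrArg List.length h2
  have hβl := List.length_pos_iff.2 hβ
  have hαl := List.length_pos_iff.2 hα
  simp only [List.length_append] at hlx hp1 hp2
  obtain ⟨s1, s2, t1, t2, x1, x2, hs, ht, rfl, hxl, hx1, hx2⟩ :=
    hx.split (p.length - y.length) (by omega)
  have hlx1 := hx1.length
  have h3 := h.append hx1
  have h4 : y ++ x1 = p := by
    rw [wpow_succ, ← List.append_assoc] at he
    exact (List.append_inj he (by simp; omega)).1
  have hs2 : s2 ≠ [] := by
    rintro rfl
    have := congrArg List.length hs
    simp at this
    omega
  have h5 : ∃ t3, v = t1 ++ t3 := by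
    have : t1 <+: v := by
      apply List.prefix_of_prefix_length_le (l₃ := v ++ wpow p k)
      · exact ⟨t2, ht.symm⟩
      · exact ⟨_, rfl⟩
      · omega
    obtain ⟨t3, ht3⟩ := this
    exact ⟨t3, ht3.symm⟩
  obtain ⟨t3, rfl⟩ := h5
  exact sh_ne hp (α := α ++ s1) (u := s2) (β := β ++ t1) (v := t3) (by simp [hα]) hs2
    (by rw [h1, hs, List.append_assoc]) (by rw [h2, List.append_assoc]) h3 h4

theorem qshW_nil_left {N : ℕ} (Q : Fin N → Fin N → K) (y : List (Fin N)) :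
    qshW Q [] y = Finsupp.single y 1 := by
  rw [qshW]

theorem qshW_nil_right {N : ℕ} (Q : Fin N → Fin N → K) (y : List (Fin N)) :
    qshW Q y [] = Finsupp.single y 1 := by
  cases y with
  | nil => rw [qshW]
  | cons a u => rw [qshW]; simp

theorem qshW_cons {N : ℕ} (Q : Fin N → Fin N → K) (a b : Fin N) (u v : List (Fin N)) :
    qshW Q (a :: u) (b :: v) = consMap a (qshW Q u (b :: v)) +
        (((a :: u).map fun c => Q c b).prod) • consMap b (qshW Q (a :: u) v) := by
  rw [qshW]

theorem consMap_apply_cons {N : ℕ} (a : Fin N) (f : List (Fin N) →₀ K) (x : List (Fin N)) :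
    consMap a f (a :: x) = f x := by
  rw [consMap, Finsupp.lmapDomain_apply]
  exact Finsupp.mapDomain_apply (List.cons_injective) f x

theorem consMap_ne_zero {N : ℕ} {a : Fin N} {f : List (Fin N) →₀ K} {x : List (Fin N)}
    (h : consMap a f x ≠ 0) : ∃ y, x = a :: y ∧ f y ≠ 0 := by
  by_cases hx : x ∈ Set.range (List.cons a)
  · obtain ⟨y, rfl⟩ := hx
    exact ⟨y, rfl, by rwa [consMap_apply_cons] at h⟩
  · exact absurd (Finsupp.mapDomain_of_notMem_range f x hx) h

theorem qshW_support {N : ℕ} (Q : Fin N → Fin N → K) : ∀ (m : ℕ) (u v x : List (Fin N)),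
    u.length + v.length ≤ m → qshW Q u v x ≠ 0 → Sh u v x := by
  intro m
  induction m with
  | zero =>
    intro u v x hm h
    have hu : u = [] := by apply List.eq_nil_of_length_eq_zero; omega
    have hv : v = [] := by apply List.eq_nil_of_length_eq_zero; omega
    subst hu hv
    rw [qshW_nil_left] at h
    have : x = [] := by
      by_contra hc
      exact h (Finsupp.single_eq_of_ne hc)
    subst this
    exact Sh.nil
  | succ m ih =>
    intro u v x hm h
    cases u with
    | nil =>
      rw [qshW_nil_left] at h
      have : x = v := by
        by_contra hc
        exact h (Finsupp.single_eq_of_ne hc)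
      subst this
      exact Sh.nil_left _
    | cons a u =>
      cases v with
      | nil =>
        rw [qshW_nil_right] at h
        have : x = a :: u := by
          by_contra hc
          exact h (Finsupp.single_eq_of_ne hc)
        subst this
        exact Sh.nil_right _
      | cons b v =>
        rw [qshW_cons, Finsupp.add_apply, Finsupp.smul_apply] at h
        by_cases h1 : consMap a (qshW Q u (b :: v)) x = 0
        · rw [h1, zero_add] at h
          obtain ⟨y, rfl, hy⟩ := consMap_ne_zero (right_ne_zero_of_mul h)
          exact Sh.right b (ih _ _ _ (by simp at hm ⊢; omega) hy)
        · obtain ⟨y, rfl, hy⟩ := consMap_ne_zero h1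
          exact Sh.left a (ih _ _ _ (by simp at hm ⊢; omega) hy)

/-- coefficient when the second word is consumed first -/
theorem coef_right {N : ℕ} (Q : Fin N → Fin N → K) {p : List (Fin N)} (hp : IsLyndon p) (k : ℕ) :
    ∀ v β : List (Fin N), β ≠ [] → p = β ++ v →
      qshW Q p (v ++ wpow p k) (v ++ wpow p (k + 1)) =
        (v.map fun b => (p.map fun c => Q c b).prod).prod *
          qshW Q p (wpow p k) (wpow p (k + 1)) := by
  intro v
  induction v with
  | nil => intro β hβ h; simp
  | cons b v ih =>
    intro β hβ h
    have ih' := ih (β ++ [b]) (by simp) (by simpa using h)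
    obtain ⟨a, p', hpe⟩ : ∃ a p', p = a :: p' := List.exists_cons_of_ne_nil hp.1
    have hz : consMap a (qshW Q p' (b :: (v ++ wpow p k))) (b :: (v ++ wpow p (k + 1))) = 0 := by
      by_contra hc
      obtain ⟨x, hx, hx2⟩ := consMap_ne_zero hc
      have h3 := qshW_support Q _ _ _ _ le_rfl hx2
      have h4 := congrArg List.length h
      refine sh_ne_pow (k := k) hp (α := [a]) (β := β) (u := p') (v := b :: v) (y := β ++ [a])
        (x := x) (by simp) hβ hpe h (Sh.append_right _ _) ?_ h3 ?_
      · simp at h4 ⊢; omega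
      · rw [wpow_succ_of h, List.append_assoc]
        congr 1
        exact hx.symm
    have key : qshW Q p (b :: (v ++ wpow p k)) =
        consMap a (qshW Q p' (b :: (v ++ wpow p k))) +
        ((p.map fun c => Q c b).prod) • consMap b (qshW Q p (v ++ wpow p k)) := by
      have := qshW_cons Q a b p' (v ++ wpow p k)
      rwa [← hpe] at this
    rw [List.cons_append, List.cons_append, key, Finsupp.add_apply, hz, zero_add,
      Finsupp.smul_apply, consMap_apply_cons, ih', List.map_cons, List.prod_cons, smul_eq_mul,
      mul_assoc]

/-- coefficient when the first word is consumed first -/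
theorem coef_left {N : ℕ} (Q : Fin N → Fin N → K) {p : List (Fin N)} (hp : IsLyndon p) (k : ℕ) :
    ∀ u α : List (Fin N), α ≠ [] → p = α ++ u →
      qshW Q u (wpow p (k + 1)) (u ++ wpow p (k + 1)) = 1 := by
  intro u
  induction u with
  | nil => intro α hα h; rw [qshW_nil_left]; simp
  | cons a u ih =>
    intro α hα h
    have ih' := ih (α ++ [a]) (by simp) (by simpa using h)
    obtain ⟨b, p', hpe⟩ : ∃ b p', p = b :: p' := List.exists_cons_of_ne_nil hp.1
    have hw : wpow p (k + 1) = b :: (p' ++ wpow p k) :=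
      wpow_succ_of (s := [b]) hpe k
    have hz : consMap b (qshW Q (a :: u) (p' ++ wpow p k)) (a :: (u ++ wpow p (k + 1))) = 0 := by
      by_contra hc
      obtain ⟨x, hx, hx2⟩ := consMap_ne_zero hc
      have h3 := qshW_support Q _ _ _ _ le_rfl hx2
      have h4 := congrArg List.length h
      refine sh_ne_pow (k := k) hp (α := α) (β := [b]) (u := a :: u) (v := p') (y := α ++ [b])
        (x := x) hα (by simp) h hpe (Sh.append_left _ _) ?_ h3 ?_
      · simp at h4 ⊢; omega
      · rw [wpow_succ_of h, List.append_assoc]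
        congr 1
        exact hx.symm
    have key : qshW Q (a :: u) (wpow p (k + 1)) = consMap a (qshW Q u (wpow p (k + 1))) +
        (((a :: u).map fun c => Q c b).prod) • consMap b (qshW Q (a :: u) (p' ++ wpow p k)) := by
      rw [hw]; exact qshW_cons Q a b u _
    rw [key, List.cons_append, Finsupp.add_apply, Finsupp.smul_apply, hz, consMap_apply_cons, ih']
    simp

theorem prod_swap {N : ℕ} (Q : Fin N → Fin N → K) (p q : List (Fin N)) :
    (p.map fun b => (q.map fun c => Q c b).prod).prod =
      (q.map fun c => (p.map fun b => Q c b).prod).prod := by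
  induction p with
  | nil => simp
  | cons a p ih => simp only [List.map_cons, List.prod_cons, ih, List.prod_map_mul]

theorem coef_pow {N : ℕ} (Q : Fin N → Fin N → K) {p : List (Fin N)} (hp : IsLyndon p) (k : ℕ) :
    qshW Q p (wpow p k) (wpow p (k + 1)) =
      ∑ i ∈ Finset.range (k + 1), ((p.map fun a => (p.map fun b => Q a b).prod).prod) ^ i := by
  induction k with
  | zero => rw [wpow_succ, wpow_zero, qshW_nil_right]; simp
  | succ k ih =>
    obtain ⟨a, p', hpe⟩ : ∃ a p', p = a :: p' := List.exists_cons_of_ne_nil hp.1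
    have hw : ∀ k, wpow p (k + 1) = a :: (p' ++ wpow p k) := by
      intro k
      exact wpow_succ_of (s := [a]) hpe k
    have key : qshW Q p (wpow p (k + 1)) = consMap a (qshW Q p' (wpow p (k + 1))) +
        ((p.map fun c => Q c a).prod) • consMap a (qshW Q p (p' ++ wpow p k)) := by
      rw [hw]
      have := qshW_cons Q a a p' (p' ++ wpow p k)
      rwa [← hpe] at this
    have hL := coef_left Q hp k p' [a] (by simp) hpe
    have hR := coef_right Q hp k p' [a] (by simp) hpe
    have hQ : ((p.map fun c => Q c a).prod) * (p'.map fun b => (p.map fun c => Q c b).prod).prod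
        = (p.map fun a => (p.map fun b => Q a b).prod).prod := by
      rw [← prod_swap Q p p]
      have : ∀ f : Fin N → K, (p.map f).prod = f a * (p'.map f).prod := by
        intro f
        rw [hpe, List.map_cons, List.prod_cons]
      rw [this (fun b => (p.map fun c => Q c b).prod)]
    rw [key, hw (k + 1), Finsupp.add_apply, Finsupp.smul_apply, consMap_apply_cons,
      consMap_apply_cons, hL, hR, smul_eq_mul, ← mul_assoc, hQ, ih, Finset.sum_range_succ' _ (k + 1),
      Finset.mul_sum, add_comm]
    simp [pow_succ']

theorem shW_single_apply {N : ℕ} (Q : Fin N → Fin N → K) (p x : List (Fin N))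
    (g : List (Fin N) →₀ K) :
    shW Q (Finsupp.single p 1) g x = ∑ y ∈ g.support, g y * qshW Q p y x := by
  rw [shW, Finsupp.sum_single_index (by simp)]
  simp [Finsupp.sum, Finsupp.finsetSum_apply]

theorem wpow_length {N : ℕ} (p : List (Fin N)) (n : ℕ) : (wpow p n).length = n * p.length := by
  simp [wpow]

theorem main_aux {N : ℕ} (Q : Fin N → Fin N → K) {p : List (Fin N)} (hp : IsLyndon p) (n : ℕ) :
    (∀ w, prodShW Q (List.replicate n p) w ≠ 0 → w ≤ wpow p n ∧ w.length = n * p.length) ∧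
    prodShW Q (List.replicate n p) (wpow p n) =
      ∏ k ∈ Finset.range n, ∑ i ∈ Finset.range (k + 1),
              ((p.map fun a => (p.map fun b => Q a b).prod).prod) ^ i := by
  induction n with
  | zero =>
    refine ⟨?_, by simp [prodShW, wpow]⟩
    intro w hw
    have : w = [] := by
      by_contra hc
      exact hw (Finsupp.single_eq_of_ne hc)
    subst this
    simp [wpow]
  | succ n ih =>
    obtain ⟨ih1, ih2⟩ := ih
    rw [List.replicate_succ, prodShW]
    constructor
    · intro w hw
      rw [shW_single_apply] at hw
      obtain ⟨y, hy, hne⟩ := Finset.exists_ne_zero_of_sum_ne_zero hw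
      have h1 := ih1 y (left_ne_zero_of_mul hne)
      have h2 := qshW_support Q _ _ _ _ le_rfl (right_ne_zero_of_mul hne)
      refine ⟨?_, by rw [h2.length, h1.2]; ring⟩
      rcases h1.1.lt_or_eq with h3 | rfl
      · obtain ⟨x', h4, h5⟩ := h2.mono _ (by rw [h1.2, wpow_length]) h3
        exact (le_of_lt h5).trans (sh_pow_le hp n _ h4)
      · exact sh_pow_le hp n _ h2
    · rw [shW_single_apply, Finset.prod_range_succ, ← ih2, ← coef_pow Q hp n]
      apply Finset.sum_eq_single (wpow p n)
      · intro y hy hne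
        by_contra hc
        have h1 := ih1 y (left_ne_zero_of_mul hc)
        have h2 := qshW_support Q _ _ _ _ le_rfl (right_ne_zero_of_mul hc)
        obtain ⟨x', h4, h5⟩ := h2.mono _ (by rw [h1.2, wpow_length]) (lt_of_le_of_ne h1.1 hne)
        exact absurd h5 (not_lt.2 (sh_pow_le hp n _ h4))
      · intro h
        rw [Finsupp.notMem_support_iff.1 h, zero_mul]

theorem stmt14 {N : ℕ} (Qm : Fin N → Fin N → K) (hQm : ∀ i j, Qm i j ≠ 0)
    (p : List (Fin N)) (hp : IsLyndon p) (n : ℕ) :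
    -- `p ш ⋯ ш p` (`n` factors) is `(n)_Q! • p^{⊗n}` plus lexicographically
    -- smaller words, where `Q = ∏_{k,l ∈ p} q_{kl}`
    ∃ r : List (Fin N) →₀ K,
      (∀ w ∈ r.support, List.Lex (· < ·) w (List.replicate n p).flatten) ∧
      prodShW Qm (List.replicate n p)
        = (∏ k ∈ Finset.range n, ∑ i ∈ Finset.range (k + 1),
              ((p.map fun a => (p.map fun b => Qm a b).prod).prod) ^ i) •
            Finsupp.single (List.replicate n p).flatten 1 + r := by
  obtain ⟨h1, h2⟩ := main_aux Qm hp n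
  refine ⟨prodShW Qm (List.replicate n p) - (∏ k ∈ Finset.range n, ∑ i ∈ Finset.range (k + 1),
              ((p.map fun a => (p.map fun b => Qm a b).prod).prod) ^ i) •
            Finsupp.single (List.replicate n p).flatten 1, ?_, by abel⟩
  intro w hw
  rw [Finsupp.mem_support_iff, Finsupp.sub_apply, Finsupp.smul_apply, ← h2] at hw
  change w < wpow p n
  have hne : w ≠ wpow p n := by
    rintro rfl
    apply hw
    simp [wpow]
  have h3 : Finsupp.single (List.replicate n p).flatten (1 : K) w = 0 :=
    Finsupp.single_eq_of_ne hne
  rw [h3, smul_zero, sub_zero] at hw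
  exact lt_of_le_of_ne (h1 w hw).1 hne
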